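/- Let β ∈ ℝ∖ℚ, u, t, s ∈ ℝ, let c ≥ 1 be an integer, k ∈ ℤ∖{0}, and q, r ∈ (1/c)·ℤ. Let p(x) = P(x) + ρ where P is a nonconstant polynomial with integer coefficients and ρ ∈ ℝ, and set a(n) = (p(n) − k·u)/(k·β). Then lim_{N→∞} (1/N)·Σ_{n=1}^N e(q·a(n) + β·r·a(n) − {a(n)}·t + {β·a(n)+u}·s) exists and equals e(−ru) · ((1/|ck|)·Σ_{j=1}^{|ck|} e(r·p(j)/k + {p(j)/k}·s)) · J_q, where J_q = 0 if q ∉ ℤ; J_q = 1 if q ∈ ℤ and q = t; J_q = 0 if q ∈ ℤ and q − t ∈ ℤ∖{0}; and J_q = (e(q−t) − 1)/(2πi(q−t)) if q ∈ ℤ and q − t ∉ ℤ. In particular the limit is 0 if and only if (1/|ck|)·Σ_{j=1}^{|ck|} e(r·p(j)/k + {p(j)/k}·s) = 0, or q ∉ ℤ, or q − t ∈ ℤ∖{0}. -/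

import Mathlib

open Filter Finset
open scoped Classical

noncomputable section

/-- `e(x) = exp(2πix)`. -/
def e (x : ℝ) : ℂ := Complex.exp (2 * (Real.pi : ℂ) * Complex.I * (x : ℂ))

/-- The factor `J_q` for real `q`: `0` if `q ∉ ℤ`; `1` if `q ∈ ℤ` and `q = t`; `0` if `q ∈ ℤ`
and `q − t ∈ ℤ∖{0}`; `(e(q−t) − 1)/(2πi(q−t))` if `q ∈ ℤ` and `q − t ∉ ℤ`. -/
def JfacR (q t : ℝ) : ℂ :=
  if ¬ ∃ m : ℤ, (m : ℝ) = q then 0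
  else if q = t then 1
  else if ∃ m : ℤ, m ≠ 0 ∧ (m : ℝ) = q - t then 0
  else (e (q - t) - 1) / (2 * (Real.pi : ℂ) * Complex.I * ((q - t : ℝ) : ℂ))

/-- The average of the first `N` terms of `f`. -/
def avg (f : ℕ → ℂ) (N : ℕ) : ℂ := (N : ℂ)⁻¹ * ∑ n ∈ range N, f n

lemma avg_add (f g : ℕ → ℂ) (N : ℕ) : avg (fun n => f n + g n) N = avg f N + avg g N := by
  simp [avg, sum_add_distrib, mul_add]

lemma avg_sub (f g : ℕ → ℂ) (N : ℕ) : avg (fun n => f n - g n) N = avg f N - avg g N := by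
  simp [avg, sum_sub_distrib, mul_sub]

lemma avg_const_mul (z : ℂ) (f : ℕ → ℂ) (N : ℕ) : avg (fun n => z * f n) N = z * avg f N := by
  simp only [avg, ← mul_sum]; ring

lemma avg_sum {ι : Type*} (s : Finset ι) (f : ι → ℕ → ℂ) (N : ℕ) :
    avg (fun n => ∑ i ∈ s, f i n) N = ∑ i ∈ s, avg (f i) N := by
  simp only [avg, ← mul_sum]; rw [sum_comm]

lemma avg_conj (f : ℕ → ℂ) (N : ℕ) :
    avg (fun n => (starRingEnd ℂ) (f n)) N = (starRingEnd ℂ) (avg f N) := by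
  simp [avg]

lemma norm_avg_le_norm_avg {f : ℕ → ℂ} {g : ℕ → ℝ} (h : ∀ n, ‖f n‖ ≤ g n) (N : ℕ) :
    ‖avg f N‖ ≤ ‖avg (fun n => (g n : ℂ)) N‖ := by
  have h0 : 0 ≤ ∑ n ∈ range N, g n :=
    sum_nonneg fun n _ => (norm_nonneg _).trans (h n)
  simp only [avg, norm_mul]
  gcongr
  rw [← Complex.ofReal_sum, Complex.norm_real, Real.norm_of_nonneg h0]
  exact norm_sum_le_of_le _ fun n _ => h n

lemma norm_avg_le {f : ℕ → ℂ} {B : ℝ} (h : ∀ n, ‖f n‖ ≤ B) (N : ℕ) : ‖avg f N‖ ≤ B := by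
  have hB : 0 ≤ B := (norm_nonneg _).trans (h 0)
  rcases Nat.eq_zero_or_pos N with rfl | hN
  · simpa [avg] using hB
  refine (norm_avg_le_norm_avg h N).trans ?_
  have : (N : ℂ) ≠ 0 := by exact_mod_cast hN.ne'
  simp [avg, this, abs_of_nonneg hB]

lemma norm_avg_sq_le (f : ℕ → ℂ) (N : ℕ) :
    ‖avg f N‖ ^ 2 ≤ ‖avg (fun n => f n * (starRingEnd ℂ) (f n)) N‖ := by
  rcases Nat.eq_zero_or_pos N with rfl | hN
  · simp [avg]
  have hN' : (0 : ℝ) < N := by exact_mod_cast hN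
  have h1 : ‖∑ n ∈ range N, f n‖ ^ 2 ≤ N * ∑ n ∈ range N, ‖f n‖ ^ 2 := by
    refine (pow_le_pow_left₀ (norm_nonneg _) (norm_sum_le _ _) 2).trans ?_
    simpa using sq_sum_le_card_mul_sum_sq (s := range N) (f := fun n => ‖f n‖)
  have h2 : ‖∑ n ∈ range N, f n * (starRingEnd ℂ) (f n)‖ = ∑ n ∈ range N, ‖f n‖ ^ 2 := by
    simp only [Complex.mul_conj']
    rw [← Real.norm_of_nonneg (sum_nonneg fun n _ => sq_nonneg ‖f n‖), ← Complex.norm_real]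
    push_cast
    rfl
  simp only [avg, norm_mul, mul_pow, h2]
  simp only [norm_inv, Complex.norm_natCast]
  calc ((N : ℝ)⁻¹) ^ 2 * ‖∑ n ∈ range N, f n‖ ^ 2
      ≤ ((N : ℝ)⁻¹) ^ 2 * (N * ∑ n ∈ range N, ‖f n‖ ^ 2) := by gcongr
    _ = _ := by field_simp

lemma tendsto_avg_shift_sub {f : ℕ → ℂ} {B : ℝ} (hf : ∀ n, ‖f n‖ ≤ B) (h : ℕ) :
    Tendsto (fun N => avg (fun n => f (n + h)) N - avg f N) atTop (nhds 0) := by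
  have hlim : Tendsto (fun N : ℕ => (2 * h * B) * (N : ℝ)⁻¹) atTop (nhds 0) := by
    simpa using tendsto_natCast_atTop_atTop.inv_tendsto_atTop.const_mul (2 * h * B)
  refine squeeze_zero_norm (fun N => ?_) hlim
  have key : ∑ n ∈ range N, f (n + h) - ∑ n ∈ range N, f n
      = ∑ n ∈ range h, f (N + n) - ∑ n ∈ range h, f n := by
    have h1 := sum_range_add f N h
    have h2 := sum_range_add f h N
    rw [add_comm h N] at h2
    rw [sub_eq_sub_iff_add_eq_add, add_comm (∑ n ∈ range h, f (N + n)), ← h1, h2, add_comm]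
    simp only [add_comm h]
  rw [avg, avg, ← mul_sub, key, norm_mul, norm_inv, Complex.norm_natCast, mul_comm]
  gcongr
  have b1 : ‖∑ n ∈ range h, f (N + n)‖ ≤ h * B := by
    simpa using norm_sum_le_of_le (range h) fun n _ => hf (N + n)
  have b2 : ‖∑ n ∈ range h, f n‖ ≤ h * B := by
    simpa using norm_sum_le_of_le (range h) fun n _ => hf n
  linarith [norm_sub_le (∑ n ∈ range h, f (N + n)) (∑ n ∈ range h, f n)]

lemma tendsto_avg_window_sub {f : ℕ → ℂ} {B : ℝ} (hf : ∀ n, ‖f n‖ ≤ B) {H : ℕ} (hH : 0 < H) :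
    Tendsto (fun N => avg (fun n => (H : ℂ)⁻¹ * ∑ h ∈ range H, f (n + h)) N - avg f N)
      atTop (nhds 0) := by
  have h1 := (tendsto_finsetSum (range H)
    fun h _ => tendsto_avg_shift_sub hf h).const_mul (H : ℂ)⁻¹
  simp only [sum_const_zero, mul_zero] at h1
  refine h1.congr fun N => ?_
  have : (H : ℂ) ≠ 0 := by exact_mod_cast hH.ne'
  rw [avg_const_mul, avg_sum, sum_sub_distrib, sum_const, card_range, nsmul_eq_mul]
  field_simp

/-- Van der Corput's difference theorem. -/
lemma tendsto_avg_of_correlations {v : ℕ → ℂ} (hv : ∀ n, ‖v n‖ ≤ 1)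
    (hcor : ∀ h : ℕ, 0 < h →
      Tendsto (avg fun n => v (n + h) * (starRingEnd ℂ) (v n)) atTop (nhds 0)) :
    Tendsto (avg v) atTop (nhds 0) := by
  have hb : ∀ i j n, ‖v (n + i) * (starRingEnd ℂ) (v (n + j))‖ ≤ 1 := fun i j n => by
    rw [norm_mul, RCLike.norm_conj]
    exact mul_le_one₀ (hv _) (norm_nonneg _) (hv _)
  have hlt : ∀ i j, j < i →
      Tendsto (avg fun n => v (n + i) * (starRingEnd ℂ) (v (n + j))) atTop (nhds 0) := by
    intro i j hij
    have h1 := hcor (i - j) (Nat.sub_pos_of_lt hij)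
    have h2 := tendsto_avg_shift_sub (f := fun n => v (n + (i - j)) * (starRingEnd ℂ) (v n))
      (B := 1) (fun n => by simpa using hb (i - j) 0 n) j
    have h3 := h2.add h1
    simp only [sub_add_cancel, add_zero] at h3
    refine h3.congr fun N => ?_
    congr 1
    funext n
    rw [show n + j + (i - j) = n + i by omega]
  have hne : ∀ i j, i ≠ j →
      Tendsto (avg fun n => v (n + i) * (starRingEnd ℂ) (v (n + j))) atTop (nhds 0) := by
    intro i j hij
    rcases lt_or_gt_of_ne hij with h | h
    · have h1 := (Complex.continuous_conj.tendsto _).comp (hlt j i h)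
      rw [map_zero] at h1
      refine h1.congr fun N => ?_
      rw [Function.comp_apply, ← avg_conj]
      congr 1
      funext n
      simp [mul_comm]
    · exact hlt i j h
  have hH : ∀ H : ℕ, 0 < H → ∃ b : ℕ → ℝ, Tendsto b atTop (nhds (Real.sqrt (H : ℝ)⁻¹)) ∧
      ∀ N, ‖avg v N‖ ≤ b N := by
    intro H hH
    have hH' : (H : ℝ) ≠ 0 := by exact_mod_cast hH.ne'
    set c : ℕ → ℕ → ℕ → ℝ := fun i j N => if i = j then 1 else
      ‖avg (fun n => v (n + i) * (starRingEnd ℂ) (v (n + j))) N‖ with hc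
    set G : ℕ → ℂ := fun n => (H : ℂ)⁻¹ * ∑ h ∈ range H, v (n + h) with hG
    have hclim : Tendsto (fun N => ((H : ℝ)⁻¹) ^ 2 * ∑ i ∈ range H, ∑ j ∈ range H, c i j N) atTop
        (nhds ((H : ℝ)⁻¹)) := by
      have h1 : ∀ i j, Tendsto (c i j) atTop (nhds (if i = j then 1 else 0)) := by
        intro i j
        by_cases hij : i = j
        · simp [hc, hij]
        · simpa [hc, hij] using (hne i j hij).norm
      have h2 := (tendsto_finsetSum (range H) fun i _ =>
        tendsto_finsetSum (range H) fun j _ => h1 i j).const_mul (((H : ℝ)⁻¹) ^ 2)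
      convert h2 using 2
      have : ∀ i ∈ range H, ∑ j ∈ range H, (if i = j then (1 : ℝ) else 0) = 1 := by
        intro i hi
        rw [sum_ite_eq, if_pos hi]
      rw [sum_congr rfl this]
      simp
      field_simp
    have herr := (tendsto_avg_window_sub hv hH).norm
    have hb' := ((Real.continuous_sqrt.tendsto _).comp hclim).add herr
    rw [norm_zero, add_zero] at hb'
    refine ⟨_, hb', fun N => ?_⟩
    have hGG : ‖avg (fun n => G n * (starRingEnd ℂ) (G n)) N‖ ≤
        ((H : ℝ)⁻¹) ^ 2 * ∑ i ∈ range H, ∑ j ∈ range H, c i j N := by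
      have h1 : (fun n => G n * (starRingEnd ℂ) (G n)) = fun n => ((H : ℂ)⁻¹) ^ 2 *
          ∑ i ∈ range H, ∑ j ∈ range H, v (n + i) * (starRingEnd ℂ) (v (n + j)) := by
        funext n
        rw [hG, ← sum_mul_sum]
        simp only [map_mul, map_inv₀, map_natCast, map_sum]
        ring
      rw [h1, avg_const_mul, avg_sum, norm_mul, norm_pow, norm_inv, Complex.norm_natCast]
      gcongr
      refine norm_sum_le_of_le _ fun i _ => ?_
      rw [avg_sum]
      refine norm_sum_le_of_le _ fun j _ => ?_
      by_cases hij : i = j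
      · simpa [hc, hij] using norm_avg_le (hb j j) N
      · simp [hc, hij]
    have hG2 : ‖avg G N‖ ≤
        Real.sqrt (((H : ℝ)⁻¹) ^ 2 * ∑ i ∈ range H, ∑ j ∈ range H, c i j N) :=
      Real.le_sqrt_of_sq_le ((norm_avg_sq_le G N).trans hGG)
    have h3 : ‖avg v N‖ ≤ ‖avg G N‖ + ‖avg G N - avg v N‖ := by
      have := norm_sub_le (avg G N) (avg G N - avg v N)
      rwa [sub_sub_cancel] at this
    exact h3.trans (add_le_add hG2 le_rfl)
  refine NormedAddGroup.tendsto_nhds_zero.2 fun ε hε => ?_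
  have hinv : Tendsto (fun H : ℕ => Real.sqrt (H : ℝ)⁻¹) atTop (nhds 0) := by
    have h0 := (Real.continuous_sqrt.tendsto 0).comp
      (tendsto_natCast_atTop_atTop (R := ℝ)).inv_tendsto_atTop
    rw [Real.sqrt_zero] at h0
    exact h0
  obtain ⟨H, hHε, hH0⟩ := ((hinv.eventually_lt_const hε).and (eventually_gt_atTop 0)).exists
  obtain ⟨b, hblim, hbv⟩ := hH H hH0
  filter_upwards [hblim.eventually_lt_const hHε] with N hN
  exact (hbv N).trans_lt hN

lemma norm_e (x : ℝ) : ‖e x‖ = 1 := by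
  rw [e, show 2 * (Real.pi : ℂ) * Complex.I * (x : ℂ) = ((2 * Real.pi * x : ℝ) : ℂ) * Complex.I by
    push_cast; ring, Complex.norm_exp_ofReal_mul_I]

lemma e_add (x y : ℝ) : e (x + y) = e x * e y := by
  simp only [e, ← Complex.exp_add]
  push_cast
  ring_nf

lemma e_conj (x : ℝ) : (starRingEnd ℂ) (e x) = e (-x) := by
  simp [e, ← Complex.exp_conj, map_ofNat]

lemma e_ne_zero (x : ℝ) : e x ≠ 0 := Complex.exp_ne_zero _

lemma e_eq_one_iff (x : ℝ) : e x = 1 ↔ ∃ m : ℤ, (m : ℝ) = x := by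
  rw [e, Complex.exp_eq_one_iff]
  refine exists_congr fun m => ?_
  rw [mul_comm (m : ℂ), mul_right_inj' Complex.two_pi_I_ne_zero, eq_comm]
  norm_cast

lemma e_intCast (m : ℤ) : e m = 1 := (e_eq_one_iff _).2 ⟨m, rfl⟩

@[fun_prop]
lemma continuous_e : Continuous e := by
  unfold e; fun_prop

lemma natDegree_taylor_sub {P : Polynomial ℤ} {d : ℕ} (hP : P.natDegree = d + 1) {r : ℤ}
    (hr : r ≠ 0) : (Polynomial.taylor r P - P).natDegree = d := by
  have hP0 : P ≠ 0 := by
    rintro rfl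
    simp at hP
  refine Polynomial.natDegree_eq_of_le_of_coeff_ne_zero ?_ ?_
  · have h1 := Polynomial.degree_sub_lt_left (Polynomial.degree_taylor P r)
      ((Polynomial.taylor_injective r).ne_iff' (map_zero _) |>.2 hP0)
      (Polynomial.leadingCoeff_taylor r P)
    rw [Polynomial.degree_taylor, Polynomial.degree_eq_natDegree hP0, hP] at h1
    exact Polynomial.natDegree_le_iff_coeff_eq_zero.2 fun N hN =>
      (Polynomial.degree_lt_iff_coeff_zero _ _).1 h1 N hN
  · have h2 : (Polynomial.hasseDeriv d P).natDegree ≤ 1 := by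
      simp [Polynomial.natDegree_hasseDeriv, hP]
    have h3 : P.coeff (d + 1) ≠ 0 := by
      rw [← hP]
      exact Polynomial.leadingCoeff_ne_zero.2 hP0
    rw [Polynomial.coeff_sub, Polynomial.taylor_coeff,
      Polynomial.eq_X_add_C_of_natDegree_le_one h2]
    simp only [Polynomial.hasseDeriv_coeff, Polynomial.eval_add, Polynomial.eval_mul,
      Polynomial.eval_C, Polynomial.eval_X, zero_add, Nat.choose_self, Nat.cast_one, one_mul,
      add_sub_cancel_right]
    rw [add_comm 1 d, Nat.choose_succ_self_right]
    refine mul_ne_zero (mul_ne_zero ?_ h3) hr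
    exact_mod_cast d.succ_ne_zero

/-- Weyl's theorem for polynomial phases with an irrational multiplier, with periodic weights. -/
lemma tendsto_avg_periodic_mul_e {α : ℝ} (hα : Irrational α) {M : ℕ} (hM : 0 < M) {d : ℕ} :
    ∀ {P : Polynomial ℤ}, P.natDegree = d + 1 → ∀ {w : ℕ → ℂ}, (∀ n, ‖w n‖ ≤ 1) →
    (∀ n, w (n + M) = w n) →
    Tendsto (avg fun n => w n * e (α * (P.eval (n : ℤ) : ℤ))) atTop (nhds 0) := by
  have hb : ∀ {P : Polynomial ℤ} {w : ℕ → ℂ}, (∀ n, ‖w n‖ ≤ 1) →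
      ∀ n : ℕ, ‖w n * e (α * (P.eval (n : ℤ) : ℤ))‖ ≤ 1 := fun hw n => by
    simpa [norm_e] using hw n
  induction d with
  | zero =>
    intro P hP w hw hper
    have hs := tendsto_avg_shift_sub (hb (P := P) hw) M
    have ha : P.coeff 1 ≠ 0 := by
      have : P.leadingCoeff ≠ 0 := Polynomial.leadingCoeff_ne_zero.2 (by rintro rfl; simp at hP)
      rwa [Polynomial.leadingCoeff, hP] at this
    have hev : ∀ x : ℤ, P.eval x = P.coeff 1 * x + P.coeff 0 := fun x => by
      conv_lhs => rw [Polynomial.eq_X_add_C_of_natDegree_le_one hP.le]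
      simp
    set z := e (α * (P.coeff 1 * M : ℤ)) with hz
    have hz1 : z - 1 ≠ 0 := by
      rw [sub_ne_zero, hz, Ne, e_eq_one_iff]
      rintro ⟨m, hm⟩
      exact (hα.mul_intCast (mul_ne_zero ha (by exact_mod_cast hM.ne'))).ne_int m hm.symm
    have hs2 := hs.const_mul (z - 1)⁻¹
    rw [mul_zero] at hs2
    refine hs2.congr fun N => ?_
    have : (fun n : ℕ => w (n + M) * e (α * (P.eval ((n + M : ℕ) : ℤ) : ℤ))) =
        fun n => z * (w n * e (α * (P.eval (n : ℤ) : ℤ))) := by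
      funext n
      rw [hper, hz, mul_left_comm, ← e_add, hev, hev]
      congr 2
      push_cast
      ring
    rw [this, avg_const_mul]
    field_simp
  | succ d ih =>
    intro P hP w hw hper
    refine tendsto_avg_of_correlations (hb hw) fun h hh => ?_
    have h1 := ih (natDegree_taylor_sub hP (r := h) (by exact_mod_cast hh.ne'))
      (w := fun n => w (n + h) * (starRingEnd ℂ) (w n)) (fun n => by
        rw [norm_mul, RCLike.norm_conj]
        exact mul_le_one₀ (hw _) (norm_nonneg _) (hw _)) (fun n => by
        simp only [hper, add_right_comm n M h])
    convert h1 using 3 with n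
    rw [map_mul, e_conj, mul_mul_mul_comm, ← e_add]
    congr 2
    simp [Polynomial.taylor_eval]
    ring

lemma sum_Icc_one_eq_sum_range (f : ℕ → ℂ) (N : ℕ) :
    ∑ n ∈ Icc 1 N, f n = ∑ n ∈ range N, f (n + 1) := by
  rw [range_eq_Ico, sum_Ico_add' f 0 N 1, zero_add]
  rfl

/-- A periodic sequence has the mean over one period as its limit average. -/
lemma tendsto_avg_of_periodic {w : ℕ → ℂ} {B : ℝ} (hw : ∀ n, ‖w n‖ ≤ B) {M : ℕ} (hM : 0 < M)
    (hper : ∀ n, w (n + M) = w n) :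
    Tendsto (avg w) atTop (nhds ((M : ℂ)⁻¹ * ∑ j ∈ Icc 1 M, w j)) := by
  have hwin : ∀ n, ∑ h ∈ range M, w (n + h) = ∑ h ∈ range M, w (0 + h) := by
    intro n
    induction n with
    | zero => rfl
    | succ n ih =>
      have h1 := sum_range_succ (fun h => w (n + h)) M
      rw [sum_range_succ', hper, add_zero, add_left_inj] at h1
      rw [← ih, ← h1]
      exact sum_congr rfl fun h _ => by ring_nf
  have h1 := tendsto_avg_window_sub hw hM
  have h2 : ∑ j ∈ Icc 1 M, w j = ∑ h ∈ range M, w (0 + h) := by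
    rw [← hwin 1, sum_Icc_one_eq_sum_range]
    exact sum_congr rfl fun h _ => by rw [add_comm]
  have h3 : Tendsto (avg fun _ => (M : ℂ)⁻¹ * ∑ h ∈ range M, w (0 + h)) atTop
      (nhds ((M : ℂ)⁻¹ * ∑ j ∈ Icc 1 M, w j)) := by
    rw [h2]
    refine tendsto_const_nhds.congr' ?_
    filter_upwards [eventually_gt_atTop 0] with N hN
    have : (N : ℂ) ≠ 0 := by exact_mod_cast hN.ne'
    simp [avg, this]
  have h4 := h3.sub h1
  simp only [hwin, sub_sub_cancel, sub_zero] at h4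
  exact h4

/-- Convergence of weighted averages of the characters of the circle implies convergence for all
continuous functions on the circle. -/
lemma tendsto_avg_mul_addCircle {v : ℕ → ℂ} (hv : ∀ n, ‖v n‖ ≤ 1) {x : ℕ → ℝ} {g : ℝ → ℂ}
    (hg : Continuous g) {K : ℝ} (hK : ∀ y, ‖g y‖ ≤ K)
    (hl : ∀ l : ℤ, Tendsto (avg fun n => v n * e (l * x n)) atTop
      (nhds (∫ y in (0 : ℝ)..1, e (l * y) * g y))) (F : C(UnitAddCircle, ℂ)) :
    Tendsto (avg fun n => v n * F (x n : UnitAddCircle)) atTop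
      (nhds (∫ y in (0 : ℝ)..1, F (y : UnitAddCircle) * g y)) := by
  have hK0 : 0 ≤ K := (norm_nonneg _).trans (hK 0)
  have hci : ∀ G : C(UnitAddCircle, ℂ), IntervalIntegrable
      (fun y : ℝ => G (y : UnitAddCircle) * g y) MeasureTheory.volume 0 1 := fun G =>
    ((G.continuous.comp (AddCircle.continuous_mk' 1)).mul hg).intervalIntegrable _ _
  have hspan : ∀ T ∈ Submodule.span ℂ (Set.range (fourier (T := 1))),
      Tendsto (avg fun n => v n * T (x n : UnitAddCircle)) atTop
        (nhds (∫ y in (0 : ℝ)..1, T (y : UnitAddCircle) * g y)) := by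
    intro T hT
    induction hT using Submodule.span_induction with
    | mem T hT =>
      obtain ⟨l, rfl⟩ := hT
      have hfe : ∀ y : ℝ, fourier l (y : UnitAddCircle) = e (l * y) := fun y => by
        rw [fourier_coe_apply, e]
        push_cast
        ring_nf
      simpa only [hfe] using hl l
    | zero =>
      have h0 : avg (fun _ => 0) = fun _ => 0 := by
        funext N
        simp [avg]
      simp [h0]
    | add S T _ _ hS hT =>
      have h1 := hS.add hT
      rw [← intervalIntegral.integral_add (hci S) (hci T)] at h1
      simp only [← avg_add, ← mul_add, ← add_mul] at h1
      exact h1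
    | smul z T _ hT =>
      have h1 := hT.const_mul z
      rw [← intervalIntegral.integral_const_mul] at h1
      simp only [← avg_const_mul, mul_left_comm z (v _), ← mul_assoc z (T _)] at h1
      exact h1
  rw [Metric.tendsto_nhds]
  intro ε hε
  have hF : F ∈ closure (Submodule.span ℂ (Set.range (fourier (T := 1))) :
      Set C(UnitAddCircle, ℂ)) := by
    rw [← Submodule.topologicalClosure_coe, span_fourier_closure_eq_top]
    trivial
  have hδ : 0 < ε / (2 + K) := by positivity
  obtain ⟨T, hT, hFT⟩ := Metric.mem_closure_iff.1 hF _ hδ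
  have hpt : ∀ y, ‖F y - T y‖ ≤ ε / (2 + K) := fun y => by
    rw [← dist_eq_norm]
    exact (ContinuousMap.dist_apply_le_dist y).trans hFT.le
  filter_upwards [Metric.tendsto_nhds.1 (hspan T hT) _ hδ] with N hN
  have h1 : ‖avg (fun n => v n * F (x n : UnitAddCircle)) N -
      avg (fun n => v n * T (x n : UnitAddCircle)) N‖ ≤ ε / (2 + K) := by
    rw [← avg_sub]
    refine norm_avg_le (fun n => ?_) N
    rw [← mul_sub, norm_mul]
    exact (mul_le_of_le_one_left (norm_nonneg _) (hv n)).trans (hpt _)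
  have h2 : ‖(∫ y in (0 : ℝ)..1, T (y : UnitAddCircle) * g y) -
      ∫ y in (0 : ℝ)..1, F (y : UnitAddCircle) * g y‖ ≤ ε / (2 + K) * K := by
    rw [← intervalIntegral.integral_sub (hci T) (hci F)]
    have := intervalIntegral.norm_integral_le_of_norm_le_const (a := 0) (b := 1)
      (f := fun y : ℝ => T (y : UnitAddCircle) * g y - F (y : UnitAddCircle) * g y)
      (C := ε / (2 + K) * K) (fun y _ => by
        rw [← sub_mul, norm_mul, norm_sub_rev]
        exact mul_le_mul (hpt _) (hK y) (norm_nonneg _) hδ.le)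
    simpa using this
  rw [dist_eq_norm] at hN ⊢
  calc _ = ‖(avg (fun n => v n * F (x n : UnitAddCircle)) N -
        avg (fun n => v n * T (x n : UnitAddCircle)) N) +
      (avg (fun n => v n * T (x n : UnitAddCircle)) N -
        ∫ y in (0 : ℝ)..1, T (y : UnitAddCircle) * g y) +
      ((∫ y in (0 : ℝ)..1, T (y : UnitAddCircle) * g y) -
        ∫ y in (0 : ℝ)..1, F (y : UnitAddCircle) * g y)‖ := by congr 1; ring
    _ < ε / (2 + K) + ε / (2 + K) + ε / (2 + K) * K := by
      refine (norm_add₃_le).trans_lt ?_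
      linarith
    _ = ε := by field_simp; ring

/-- As `tendsto_avg_mul_addCircle`, for a function of the fractional part. -/
lemma tendsto_avg_mul_fract_of_eq {v : ℕ → ℂ} (hv : ∀ n, ‖v n‖ ≤ 1) {x : ℕ → ℝ} {g : ℝ → ℂ}
    (hg : Continuous g) {K : ℝ} (hK : ∀ y, ‖g y‖ ≤ K)
    (hl : ∀ l : ℤ, Tendsto (avg fun n => v n * e (l * x n)) atTop
      (nhds (∫ y in (0 : ℝ)..1, e (l * y) * g y))) {f : ℝ → ℂ} (hf : Continuous f)
    (hf01 : f 0 = f 1) :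
    Tendsto (avg fun n => v n * f (Int.fract (x n))) atTop
      (nhds (∫ y in (0 : ℝ)..1, f y * g y)) := by
  have h1 := tendsto_avg_mul_addCircle hv hg hK hl
    ⟨AddCircle.liftIco 1 0 f, AddCircle.liftIco_zero_continuous hf01 hf.continuousOn⟩
  have hfr : ∀ y : ℝ, AddCircle.liftIco 1 0 f (y : UnitAddCircle) = f (Int.fract y) := by
    intro y
    rw [← AddCircle.coe_fract, AddCircle.liftIco_coe_apply]
    simp [Int.fract_nonneg, Int.fract_lt_one]
  simp only [ContinuousMap.coe_mk, hfr] at h1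
  convert h1 using 2
  refine intervalIntegral.integral_congr_Ioo_of_le zero_le_one fun y hy => ?_
  simp only [Int.fract_eq_self.2 ⟨hy.1.le, hy.2⟩]

/-- As `tendsto_avg_mul_fract_of_eq`, without matching boundary values, provided `x` is
equidistributed modulo one. -/
lemma tendsto_avg_mul_fract {v : ℕ → ℂ} (hv : ∀ n, ‖v n‖ ≤ 1) {x : ℕ → ℝ} {g : ℝ → ℂ}
    (hg : Continuous g) {K : ℝ} (hK : ∀ y, ‖g y‖ ≤ K)
    (hl : ∀ l : ℤ, Tendsto (avg fun n => v n * e (l * x n)) atTop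
      (nhds (∫ y in (0 : ℝ)..1, e (l * y) * g y)))
    (hx : ∀ l : ℤ, Tendsto (avg fun n => e (l * x n)) atTop
      (nhds (∫ y in (0 : ℝ)..1, e (l * y)))) {f : ℝ → ℂ} (hf : Continuous f)
    (hf1 : ∀ y, ‖f y‖ ≤ 1) :
    Tendsto (avg fun n => v n * f (Int.fract (x n))) atTop
      (nhds (∫ y in (0 : ℝ)..1, f y * g y)) := by
  have hK0 : 0 ≤ K := (norm_nonneg _).trans (hK 0)
  have hint : ∀ m : ℕ, ∫ y in (0 : ℝ)..1, (2 * y - 1) ^ (2 * m) = (2 * (m : ℝ) + 1)⁻¹ := by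
    intro m
    rw [intervalIntegral.integral_comp_mul_sub (fun y => y ^ (2 * m)) two_ne_zero]
    norm_num [integral_pow, (even_two_mul m).neg_one_pow, pow_succ]
    field_simp
  rw [Metric.tendsto_nhds]
  intro ε hε
  have hm : Tendsto (fun m : ℕ => (2 * (m : ℝ) + 1)⁻¹) atTop (nhds 0) := by
    refine Tendsto.inv_tendsto_atTop (tendsto_atTop_add_const_right _ _ ?_)
    exact tendsto_natCast_atTop_atTop.const_mul_atTop two_pos
  have hδ : 0 < ε / (3 + K) := by positivity
  obtain ⟨m, hm⟩ := (hm.eventually_lt_const hδ).exists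
  set h : ℝ → ℝ := fun y => (2 * y - 1) ^ (2 * m) with hh
  have hhc : Continuous h := by fun_prop
  have hh0 : ∀ y, 0 ≤ h y := fun y => (even_two_mul m).pow_nonneg _
  have hA := tendsto_avg_mul_fract_of_eq hv hg hK hl (f := fun y => (1 - h y : ℝ) * f y)
    (by fun_prop) (by norm_num [hh])
  have hB := tendsto_avg_mul_fract_of_eq (v := fun _ => 1) (x := x) (g := fun _ => 1)
    (by simp) continuous_const (K := 1) (by simp) (by simpa using hx) (f := fun y => (h y : ℂ))
    (by fun_prop) (by norm_num [hh])
  simp only [one_mul, mul_one, intervalIntegral.integral_ofReal, hh, hint] at hB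
  have hB' := hB.norm
  rw [Complex.norm_real, Real.norm_of_nonneg (by positivity)] at hB'
  have hc1 : IntervalIntegrable (fun y => ((1 - h y : ℝ) : ℂ) * f y * g y)
      MeasureTheory.volume 0 1 := Continuous.intervalIntegrable (by fun_prop) _ _
  have hc2 : IntervalIntegrable (fun y => f y * g y) MeasureTheory.volume 0 1 :=
    Continuous.intervalIntegrable (by fun_prop) _ _
  have h2 : ‖(∫ y in (0 : ℝ)..1, ((1 - h y : ℝ) : ℂ) * f y * g y) -
      ∫ y in (0 : ℝ)..1, f y * g y‖ ≤ ε / (3 + K) * K := by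
    rw [← intervalIntegral.integral_sub hc1 hc2]
    refine (intervalIntegral.norm_integral_le_of_norm_le zero_le_one (g := fun y => h y * K)
      (Eventually.of_forall fun y _ => ?_)
      (Continuous.intervalIntegrable (by fun_prop) _ _)).trans ?_
    · rw [← sub_mul, norm_mul, show ((1 - h y : ℝ) : ℂ) * f y - f y = -((h y : ℂ) * f y) by
        push_cast; ring, norm_neg, norm_mul, Complex.norm_real, Real.norm_of_nonneg (hh0 y)]
      exact mul_le_mul (mul_le_of_le_one_right (hh0 y) (hf1 y)) (hK y) (norm_nonneg _) (hh0 y)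
    · rw [intervalIntegral.integral_mul_const, hint]
      gcongr
  filter_upwards [Metric.tendsto_nhds.1 hA _ hδ, hB'.eventually_lt_const hm] with N hNA hNB
  have h1 : ‖avg (fun n => v n * f (Int.fract (x n))) N -
      avg (fun n => v n * (((1 - h (Int.fract (x n)) : ℝ) : ℂ) * f (Int.fract (x n)))) N‖ ≤
      ε / (3 + K) := by
    rw [← avg_sub]
    refine (norm_avg_le_norm_avg (g := fun n => h (Int.fract (x n))) (fun n => ?_) N).trans hNB.le
    rw [show v n * f (Int.fract (x n)) -
        v n * (((1 - h (Int.fract (x n)) : ℝ) : ℂ) * f (Int.fract (x n))) =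
        v n * f (Int.fract (x n)) * (h (Int.fract (x n)) : ℂ) by push_cast; ring,
      norm_mul, norm_mul, Complex.norm_real, Real.norm_of_nonneg (hh0 _)]
    exact mul_le_of_le_one_left (hh0 _) (mul_le_one₀ (hv n) (norm_nonneg _) (hf1 _))
  rw [dist_eq_norm] at hNA ⊢
  calc _ = ‖(avg (fun n => v n * f (Int.fract (x n))) N -
      avg (fun n => v n * (((1 - h (Int.fract (x n)) : ℝ) : ℂ) * f (Int.fract (x n)))) N) +
      (avg (fun n => v n * (((1 - h (Int.fract (x n)) : ℝ) : ℂ) * f (Int.fract (x n)))) N -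
        ∫ y in (0 : ℝ)..1, ((1 - h y : ℝ) : ℂ) * f y * g y) +
      ((∫ y in (0 : ℝ)..1, ((1 - h y : ℝ) : ℂ) * f y * g y) -
        ∫ y in (0 : ℝ)..1, f y * g y)‖ := by congr 1; ring
    _ < ε / (3 + K) + ε / (3 + K) + ε / (3 + K) * K + ε / (3 + K) := by
      refine (norm_add₃_le).trans_lt ?_
      linarith
    _ = ε := by field_simp; ring

lemma integral_e_mul {x : ℝ} (hx : x ≠ 0) :
    ∫ y in (0 : ℝ)..1, e (x * y) = (e x - 1) / (2 * (Real.pi : ℂ) * Complex.I * (x : ℂ)) := by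
  have h := integral_exp_mul_complex (a := 0) (b := 1)
    (mul_ne_zero Complex.two_pi_I_ne_zero (Complex.ofReal_ne_zero.2 hx))
  simpa [e, mul_assoc] using h

lemma integral_e_intCast_mul (l : ℤ) :
    ∫ y in (0 : ℝ)..1, e (l * y) = if l = 0 then 1 else 0 := by
  split_ifs with hl
  · simp [hl, e]
  · rw [integral_e_mul (Int.cast_ne_zero.2 hl), e_intCast, sub_self, zero_div]

lemma JfacR_intCast (m : ℤ) (t : ℝ) : JfacR m t = ∫ y in (0 : ℝ)..1, e ((m - t) * y) := by
  rw [JfacR, if_neg (not_not.2 ⟨m, rfl⟩)]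
  split_ifs with h1 h2
  · simp [h1, e]
  · obtain ⟨l, hl, hlt⟩ := h2
    rw [← hlt, integral_e_intCast_mul, if_neg hl]
  · rw [integral_e_mul (sub_ne_zero.2 h1)]

lemma JfacR_eq_zero_iff (q t : ℝ) :
    JfacR q t = 0 ↔ (¬ ∃ m : ℤ, (m : ℝ) = q) ∨ ∃ m : ℤ, m ≠ 0 ∧ (m : ℝ) = q - t := by
  by_cases h1 : ∃ m : ℤ, (m : ℝ) = q
  swap
  · simp [JfacR, h1]
  by_cases h2 : q = t
  · rw [JfacR, if_neg (not_not.2 h1), if_pos h2]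
    refine iff_of_false one_ne_zero (not_or.2 ⟨not_not.2 h1, ?_⟩)
    rintro ⟨m, hm, hmt⟩
    rw [h2, sub_self, Int.cast_eq_zero] at hmt
    exact hm hmt
  by_cases h3 : ∃ m : ℤ, m ≠ 0 ∧ (m : ℝ) = q - t
  · rw [JfacR, if_neg (not_not.2 h1), if_neg h2, if_pos h3]
    exact iff_of_true rfl (Or.inr h3)
  · rw [JfacR, if_neg (not_not.2 h1), if_neg h2, if_neg h3]
    have hqt := sub_ne_zero.2 h2
    refine iff_of_false (div_ne_zero (fun h => h3 ?_)
      (mul_ne_zero Complex.two_pi_I_ne_zero (Complex.ofReal_ne_zero.2 hqt)))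
      (not_or.2 ⟨not_not.2 h1, h3⟩)
    obtain ⟨m, hm⟩ := (e_eq_one_iff _).1 (sub_eq_zero.1 h)
    refine ⟨m, ?_, hm⟩
    rintro rfl
    exact hqt (by simpa using hm.symm)

/-- The weights `e (r * p n / k + {p n / k} * s)` are periodic modulo `|c * k|`. -/
lemma periodic_weight {c : ℕ} (hc : c ≠ 0) {k : ℤ} (hk : k ≠ 0) {r : ℝ}
    (hr : ∃ m : ℤ, r = (m : ℝ) / (c : ℝ)) (s : ℝ) (P : Polynomial ℤ) (ρ : ℝ)
    {p : ℕ → ℝ} (hp : ∀ n, p n = ((P.eval (n : ℤ) : ℤ) : ℝ) + ρ) (n : ℕ) :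
    e (r * p (n + ((c : ℤ) * k).natAbs) / k +
      Int.fract (p (n + ((c : ℤ) * k).natAbs) / (k : ℝ)) * s) =
    e (r * p n / k + Int.fract (p n / (k : ℝ)) * s) := by
  obtain ⟨m, rfl⟩ := hr
  have hc' : (c : ℝ) ≠ 0 := by exact_mod_cast hc
  have hk' : (k : ℝ) ≠ 0 := by exact_mod_cast hk
  obtain ⟨z, hz⟩ : (c : ℤ) * k ∣
      P.eval ((n + ((c : ℤ) * k).natAbs : ℕ) : ℤ) - P.eval (n : ℤ) := by
    refine dvd_trans ?_ (Polynomial.sub_dvd_eval_sub _ _ P)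
    rw [Nat.cast_add, add_sub_cancel_left]
    exact Int.dvd_natAbs.2 dvd_rfl
  have hpz : p (n + ((c : ℤ) * k).natAbs) = p n + c * k * z := by
    have hzr : ((P.eval ((n + ((c : ℤ) * k).natAbs : ℕ) : ℤ) : ℤ) : ℝ) -
        (P.eval (n : ℤ) : ℤ) = c * k * z := by exact_mod_cast hz
    rw [hp, hp]
    linarith
  have h1 : p (n + ((c : ℤ) * k).natAbs) / k = p n / k + ((c * z : ℤ) : ℝ) := by
    rw [hpz]
    push_cast
    field_simp
  have h2 : (m : ℝ) / c * p (n + ((c : ℤ) * k).natAbs) / k =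
      m / c * p n / k + ((m * z : ℤ) : ℝ) := by
    rw [hpz]
    push_cast
    field_simp
  rw [h1, h2, Int.fract_add_intCast, add_right_comm, e_add _ ((m * z : ℤ) : ℝ), e_intCast, mul_one]

/-- Let `β` be irrational, `c ≥ 1`, `k ∈ ℤ∖{0}`, `q, r ∈ (1/c)·ℤ`,
`p(x) = P(x) + ρ` with `P ∈ ℤ[x]` nonconstant, and `a(n) = (p(n) − ku)/(kβ)`. Then the
averages `(1/N)·Σ e(q·a(n) + βr·a(n) − {a(n)}t + {βa(n)+u}s)` converge to
`e(−ru)·S·J_q` where `S = (1/|ck|)·Σ_{j=1}^{|ck|} e(r·p(j)/k + {p(j)/k}·s)`, and the limit is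
`0` iff `S = 0`, or `q ∉ ℤ`, or `q − t ∈ ℤ∖{0}`. -/
theorem stmt8 (β : ℝ) (hβ : Irrational β) (u t s : ℝ) (c : ℕ) (hc : 1 ≤ c)
    (k : ℤ) (hk : k ≠ 0) (q r : ℝ)
    (hq : ∃ m : ℤ, q = (m : ℝ) / (c : ℝ)) (hr : ∃ m : ℤ, r = (m : ℝ) / (c : ℝ))
    (P : Polynomial ℤ) (hP : 0 < P.natDegree) (ρ : ℝ)
    (p : ℕ → ℝ) (hp : ∀ n, p n = ((P.eval (n : ℤ) : ℤ) : ℝ) + ρ)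
    (a : ℕ → ℝ) (ha : ∀ n, a n = (p n - (k : ℝ) * u) / ((k : ℝ) * β)) :
    Tendsto (fun N : ℕ => (N : ℂ)⁻¹ * ∑ n ∈ Finset.Icc 1 N,
        e (q * a n + β * r * a n - Int.fract (a n) * t + Int.fract (β * a n + u) * s))
      atTop
      (nhds (e (-(r * u)) *
        ((((((c : ℤ) * k).natAbs : ℕ) : ℂ))⁻¹ * ∑ j ∈ Finset.Icc 1 ((c : ℤ) * k).natAbs,
          e (r * p j / (k : ℝ) + Int.fract (p j / (k : ℝ)) * s)) * JfacR q t)) ∧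
    (e (-(r * u)) *
        ((((((c : ℤ) * k).natAbs : ℕ) : ℂ))⁻¹ * ∑ j ∈ Finset.Icc 1 ((c : ℤ) * k).natAbs,
          e (r * p j / (k : ℝ) + Int.fract (p j / (k : ℝ)) * s)) * JfacR q t = 0 ↔
      ((((((c : ℤ) * k).natAbs : ℕ) : ℂ))⁻¹ * ∑ j ∈ Finset.Icc 1 ((c : ℤ) * k).natAbs,
          e (r * p j / (k : ℝ) + Int.fract (p j / (k : ℝ)) * s)) = 0 ∨
        (¬ ∃ m : ℤ, (m : ℝ) = q) ∨ ∃ m : ℤ, m ≠ 0 ∧ (m : ℝ) = q - t) := by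
  have hc0 : c ≠ 0 := by omega
  have hc' : (c : ℝ) ≠ 0 := by exact_mod_cast hc0
  have hk' : (k : ℝ) ≠ 0 := by exact_mod_cast hk
  have hβ0 : β ≠ 0 := hβ.ne_zero
  set M := ((c : ℤ) * k).natAbs with hMdef
  have hM : 0 < M := Int.natAbs_pos.2 (mul_ne_zero (by exact_mod_cast hc0) hk)
  set w : ℕ → ℂ := fun n => e (r * p n / (k : ℝ) + Int.fract (p n / (k : ℝ)) * s) with hw
  have hw1 : ∀ n, ‖w n‖ ≤ 1 := fun n => (norm_e _).le
  have hwper : ∀ n, w (n + M) = w n := periodic_weight hc0 hk hr s P ρ hp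
  set W : ℂ := (M : ℂ)⁻¹ * ∑ j ∈ Icc 1 M, w j with hW
  have hWlim : Tendsto (avg w) atTop (nhds W) := tendsto_avg_of_periodic hw1 hM hwper
  constructor
  swap
  · rw [mul_eq_zero, mul_eq_zero, JfacR_eq_zero_iff]
    simp only [e_ne_zero, false_or]
  have hexp : ∀ {M' : ℕ}, 0 < M' → ∀ {w' : ℕ → ℂ}, (∀ n, ‖w' n‖ ≤ 1) →
      (∀ n, w' (n + M') = w' n) → ∀ m : ℤ, m ≠ 0 →
      Tendsto (avg fun n => w' n * e ((m : ℝ) / c * a n)) atTop (nhds 0) := by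
    intro M' hM' w' hw' hper m hm
    have hα : Irrational ((m : ℝ) / c / (k * β)) := by
      have h := hβ.inv.ratCast_mul (q := (m : ℚ) / (c * k)) (by positivity)
      convert h using 1
      push_cast
      field_simp
    have h := (tendsto_avg_periodic_mul_e hα hM' (Nat.succ_pred_eq_of_pos hP).symm hw'
      hper).const_mul (e ((m : ℝ) / c * ((ρ - k * u) / (k * β))))
    rw [mul_zero] at h
    simp only [← avg_const_mul] at h
    convert h using 3 with n
    rw [mul_left_comm, ← e_add, ha, hp]
    congr 2
    ring
  obtain ⟨m, rfl⟩ := hq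
  have hx : ∀ l : ℤ, Tendsto (avg fun n => e (l * a n)) atTop
      (nhds (∫ y in (0 : ℝ)..1, e (l * y))) := by
    intro l
    rw [integral_e_intCast_mul]
    split_ifs with hl
    · simpa [hl, e] using tendsto_avg_of_periodic (w := fun _ => 1) (B := 1) (by simp)
        one_pos (fun _ => rfl)
    · have h := hexp one_pos (w' := fun _ => 1) (by simp) (fun _ => rfl) (l * c)
        (mul_ne_zero hl (by exact_mod_cast hc0))
      simpa [hc'] using h
  have hv1 : ∀ n, ‖w n * e ((m : ℝ) / c * a n)‖ ≤ 1 := fun n => by simpa [norm_e] using hw1 n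
  have hft : Continuous fun y => e (-t * y) := by fun_prop
  have hvl : ∀ l : ℤ, m + l * c ≠ 0 →
      Tendsto (avg fun n => w n * e ((m : ℝ) / c * a n) * e (l * a n)) atTop (nhds 0) := by
    intro l hl
    convert hexp hM hw1 hwper _ hl using 3 with n
    rw [mul_assoc, ← e_add]
    congr 2
    push_cast
    field_simp
  have hmain : Tendsto (avg fun n => w n * e ((m : ℝ) / c * a n) * e (-t * Int.fract (a n))) atTop
      (nhds (W * JfacR ((m : ℝ) / c) t)) := by
    by_cases hq : ∃ z : ℤ, (z : ℝ) = (m : ℝ) / c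
    · obtain ⟨z, hz⟩ := hq
      rw [← hz, JfacR_intCast, ← intervalIntegral.integral_const_mul]
      have h := tendsto_avg_mul_fract hv1 (g := fun y => W * e (z * y)) (by fun_prop)
        (K := ‖W‖) (fun y => by rw [norm_mul, norm_e, mul_one]) (fun l => ?_) hx hft
        (fun y => (norm_e _).le)
      · rw [← hz] at h
        convert h using 2
        congr 1
        funext y
        rw [mul_left_comm, ← e_add]
        ring_nf
      · have hint : ∫ y in (0 : ℝ)..1, e (l * y) * (W * e (z * y)) =
            W * if l + z = 0 then 1 else 0 := by
          rw [← integral_e_intCast_mul, ← intervalIntegral.integral_const_mul]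
          congr 1
          funext y
          rw [mul_left_comm, ← e_add]
          push_cast
          ring_nf
        have hmz : m = z * c := by
          rw [eq_div_iff hc'] at hz
          exact_mod_cast hz.symm
        rw [hint]
        split_ifs with hl
        · rw [mul_one]
          convert hWlim using 3 with n
          rw [mul_assoc, ← e_add, ← hz, ← add_mul, ← Int.cast_add, add_comm z, hl]
          simp [e]
        · rw [mul_zero]
          refine hvl l ?_
          rw [hmz, ← add_mul, add_comm]
          exact mul_ne_zero hl (by exact_mod_cast hc0)
    · have h := tendsto_avg_mul_fract hv1 (g := fun _ => 0) continuous_const (K := 0) (by simp)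
        (fun l => ?_) hx hft (fun y => (norm_e _).le)
      · rw [(JfacR_eq_zero_iff _ _).2 (Or.inl hq), mul_zero]
        simpa using h
      · simp only [mul_zero, intervalIntegral.integral_zero]
        refine hvl l fun h0 => hq ⟨-l, ?_⟩
        have h1 : (m : ℝ) + l * c = 0 := by exact_mod_cast h0
        rw [eq_div_iff hc']
        push_cast
        linarith
  have hsum : ∀ n, e ((m : ℝ) / c * a n + β * r * a n - Int.fract (a n) * t +
      Int.fract (β * a n + u) * s) =
      e (-(r * u)) * (w n * e ((m : ℝ) / c * a n) * e (-t * Int.fract (a n))) := by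
    intro n
    have hβa : β * a n = p n / k - u := by
      rw [ha]
      field_simp
    rw [hw, ← e_add, ← e_add, ← e_add, mul_right_comm, hβa, sub_add_cancel]
    ring_nf
  have hlim := hmain.const_mul (e (-(r * u)))
  simp only [← avg_const_mul, ← hsum] at hlim
  have hfin := (tendsto_avg_shift_sub (fun n => (norm_e ((m : ℝ) / c * a n + β * r * a n -
    Int.fract (a n) * t + Int.fract (β * a n + u) * s)).le) 1).add hlim
  simp only [sub_add_cancel, zero_add] at hfin
  rw [mul_assoc]
  refine hfin.congr fun N => ?_
  rw [sum_Icc_one_eq_sum_range, avg]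

end
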